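/- arXiv:2002.03323 — 6 statements merged into one kernel-verified Lean document; each statement's English description precedes it below -/
import Mathlib

section
/- Let a ≥ 0 and b1, b2 > 0 be real numbers. Then ∫_{(0,∞)^5} exp(-(a w + b1 x1 y1 + b2 x2 y2)) · e^{-w - x1 - y1 - x2 - y2} dw dx1 dy1 dx2 dy2 = (1 + a)^{-1} · ∏_{n=1}^{2} b_n^{-1} e^{1/b_n} Γ(0, 1/b_n), where Γ(0, x) = ∫_x^∞ u^{-1} e^{-u} du. (This is the Chernoff-bound expectation over the fading coefficients for blind AEH-relaying, yielding eq. (33) of the paper.) -/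
open MeasureTheory Set

/-- The upper incomplete gamma function `Γ(0, x) = ∫_x^∞ u⁻¹ e^{-u} du`. -/
noncomputable def Gamma0 (x : ℝ) : ℝ := ∫ u in Ioi x, u⁻¹ * Real.exp (-u)

/-- The Laplace transform of the unit exponential law. -/
theorem integral_exp_neg_mul_mul_exp_neg_Ioi {c : ℝ} (hc : 0 ≤ c) :
    ∫ t in Ioi (0 : ℝ), Real.exp (-(c * t)) * Real.exp (-t) = (1 + c)⁻¹ := by
  have h := integral_exp_mul_Ioi (a := -(1 + c)) (by linarith) 0
  calc
    _ = ∫ t in Ioi (0 : ℝ), Real.exp (-(1 + c) * t) := by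
      congr 1 with t
      rw [← Real.exp_add]
      ring_nf
    _ = (1 + c)⁻¹ := by
      rw [h, mul_zero, Real.exp_zero, neg_div_neg_eq, one_div]

theorem integral_inv_one_add_mul_mul_exp_neg_Ioi {b : ℝ} (hb : 0 < b) :
    ∫ x in Ioi (0 : ℝ), (1 + b * x)⁻¹ * Real.exp (-x) =
      b⁻¹ * Real.exp (1 / b) * Gamma0 (1 / b) := by
  have hshift := (measurePreserving_add_right volume (1 / b)).setIntegral_preimage_emb
    (measurableEmbedding_addRight (1 / b)) (fun u : ℝ => u⁻¹ * Real.exp (-u)) (Ioi (1 / b))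
  rw [preimage_add_const_Ioi, sub_self] at hshift
  rw [Gamma0, ← hshift, ← integral_const_mul]
  refine setIntegral_congr_fun measurableSet_Ioi fun x (hx : 0 < x) => ?_
  have hexp : Real.exp (-x) = Real.exp (1 / b) * Real.exp (-(x + 1 / b)) := by
    rw [← Real.exp_add]
    ring_nf
  have hinv : (1 + b * x)⁻¹ = b⁻¹ * (x + 1 / b)⁻¹ := by
    rw [← mul_inv, mul_add, mul_one_div_cancel hb.ne', add_comm]
  rw [hexp, hinv]
  ring

/-- The Laplace transform of the product of two independent unit exponential variables. -/
theorem integral_exp_neg_mul_mul_Ioi {b : ℝ} (hb : 0 < b) :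
    ∫ x in Ioi (0 : ℝ), ∫ y in Ioi (0 : ℝ),
        Real.exp (-x) * (Real.exp (-(b * x * y)) * Real.exp (-y)) =
      b⁻¹ * Real.exp (1 / b) * Gamma0 (1 / b) := by
  rw [← integral_inv_one_add_mul_mul_exp_neg_Ioi hb]
  refine setIntegral_congr_fun measurableSet_Ioi fun x (hx : 0 < x) => ?_
  rw [integral_const_mul, integral_exp_neg_mul_mul_exp_neg_Ioi (by positivity), mul_comm]

/-- Chernoff-bound expectation over the fading coefficients for blind AEH-relaying
(eq. (33)): for `a ≥ 0`, `b1, b2 > 0`,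
`∫_{(0,∞)^5} e^{-(a w + b1 x1 y1 + b2 x2 y2)} e^{-w-x1-y1-x2-y2}
  = (1+a)⁻¹ ∏ₙ bₙ⁻¹ e^{1/bₙ} Γ(0, 1/bₙ)`. -/
theorem blind_AEH_chernoff_expectation (a b1 b2 : ℝ) (ha : 0 ≤ a) (hb1 : 0 < b1)
    (hb2 : 0 < b2) :
    (∫ w in Ioi (0 : ℝ), ∫ x1 in Ioi (0 : ℝ), ∫ y1 in Ioi (0 : ℝ),
      ∫ x2 in Ioi (0 : ℝ), ∫ y2 in Ioi (0 : ℝ),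
        Real.exp (-(a * w + b1 * x1 * y1 + b2 * x2 * y2)) *
          Real.exp (-w - x1 - y1 - x2 - y2)) =
    (1 + a)⁻¹ * ((b1⁻¹ * Real.exp (1 / b1) * Gamma0 (1 / b1)) *
      (b2⁻¹ * Real.exp (1 / b2) * Gamma0 (1 / b2))) := by
  have hfactor (w x1 y1 x2 y2 : ℝ) :
      Real.exp (-(a * w + b1 * x1 * y1 + b2 * x2 * y2)) * Real.exp (-w - x1 - y1 - x2 - y2) =
        Real.exp (-(a * w)) * Real.exp (-w) *
          (Real.exp (-x1) * (Real.exp (-(b1 * x1 * y1)) * Real.exp (-y1))) *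
          (Real.exp (-x2) * (Real.exp (-(b2 * x2 * y2)) * Real.exp (-y2))) := by
    simp only [← Real.exp_add]
    ring_nf
  have h2 (c : ℝ) : ∫ x in Ioi (0 : ℝ), ∫ y in Ioi (0 : ℝ),
      c * (Real.exp (-x) * (Real.exp (-(b2 * x * y)) * Real.exp (-y))) =
        c * (b2⁻¹ * Real.exp (1 / b2) * Gamma0 (1 / b2)) := by
    rw [← integral_exp_neg_mul_mul_Ioi hb2, ← integral_const_mul]
    simp_rw [integral_const_mul]
  have h1 (c d : ℝ) : ∫ x in Ioi (0 : ℝ), ∫ y in Ioi (0 : ℝ),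
      c * (Real.exp (-x) * (Real.exp (-(b1 * x * y)) * Real.exp (-y))) * d =
        c * (b1⁻¹ * Real.exp (1 / b1) * Gamma0 (1 / b1)) * d := by
    rw [← integral_exp_neg_mul_mul_Ioi hb1]
    simp_rw [integral_mul_const, integral_const_mul]
  simp_rw [hfactor, h2, h1,
    integral_mul_const, integral_exp_neg_mul_mul_exp_neg_Ioi ha, mul_assoc]
end

section
/- Let ξ > 0 and let X, Y be independent unit-mean exponential random variables (density e^{-x} on (0,∞)). Define Z = X^2 Y / (ξ X + 1). Then for every z ≥ 0, P(Z ≤ z) = ∫_0^z ∫_0^∞ (ξ (t + 1) / t^2) · exp( - t/ξ - ξ^2 (t + 1) w / t^2 ) dt dw; equivalently, Z has probability density f_Z(z) = ∫_0^∞ (ξ (t + 1)/t^2) exp( - t/ξ - ξ^2 (t + 1) z / t^2 ) dt on (0,∞). (This is the exact density derived via the Jacobian transformation in Appendix B, eq. (48).) -/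
open MeasureTheory Set

/-- The antiderivative of the exponential density of rate `a`, valid for every real `a`. -/
lemma integral_mul_exp_neg_mul (a z : ℝ) :
    ∫ w in (0 : ℝ)..z, a * Real.exp (-(a * w)) = 1 - Real.exp (-(a * z)) := by
  have hderiv : ∀ w ∈ uIcc 0 z,
      HasDerivAt (fun w : ℝ => -Real.exp (-(a * w))) (a * Real.exp (-(a * w))) w := by
    intro w _
    refine (((hasDerivAt_id w).const_mul a).neg.exp).neg.congr_deriv ?_
    simp only [id, Pi.neg_apply]
    ring
  rw [intervalIntegral.integral_eq_sub_of_hasDerivAt hderiv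
    (Continuous.intervalIntegrable (by fun_prop) _ _)]
  simp
  ring

/-- The cumulative distribution function of the unit-mean exponential law. -/
lemma integral_Ioi_ite_le_mul_exp_neg {c : ℝ} (hc : 0 ≤ c) :
    ∫ y in Ioi (0 : ℝ), (if y ≤ c then (1 : ℝ) else 0) * Real.exp (-y) =
      1 - Real.exp (-c) := by
  have hind : (fun y : ℝ => (if y ≤ c then (1 : ℝ) else 0) * Real.exp (-y)) =
      (Iic c).indicator fun y => Real.exp (-y) := by
    ext y
    by_cases h : y ≤ c <;> simp [h]
  rw [hind, setIntegral_indicator measurableSet_Iic, Ioi_inter_Iic,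
    ← intervalIntegral.integral_of_le hc]
  simp

/-- Integrating the joint density of `(ξ X, Z)` over `0 < Z ≤ z`. -/
lemma integral_joint_density {ξ : ℝ} (hξ : 0 < ξ) (z : ℝ) {t : ℝ} (ht : 0 < t) :
    ∫ w in (0 : ℝ)..z,
        ξ * (t + 1) / t ^ 2 * Real.exp (-(t / ξ) - ξ ^ 2 * (t + 1) * w / t ^ 2) =
      ξ⁻¹ * Real.exp (-(t / ξ)) * (1 - Real.exp (-(ξ ^ 2 * (t + 1) / t ^ 2 * z))) := by
  rw [← integral_mul_exp_neg_mul, ← intervalIntegral.integral_const_mul]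
  congr 1
  ext w
  rw [sub_eq_add_neg, Real.exp_add, show ξ ^ 2 * (t + 1) * w / t ^ 2 =
    ξ ^ 2 * (t + 1) / t ^ 2 * w by ring]
  field_simp

lemma integrable_joint_density {ξ : ℝ} (hξ : 0 < ξ) {z : ℝ} (hz : 0 ≤ z) :
    Integrable (Function.uncurry fun w t : ℝ =>
        ξ * (t + 1) / t ^ 2 * Real.exp (-(t / ξ) - ξ ^ 2 * (t + 1) * w / t ^ 2))
      ((volume.restrict (Ioc 0 z)).prod (volume.restrict (Ioi 0))) := by
  have hmeas : Measurable (Function.uncurry fun w t : ℝ =>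
      ξ * (t + 1) / t ^ 2 * Real.exp (-(t / ξ) - ξ ^ 2 * (t + 1) * w / t ^ 2)) := by
    unfold Function.uncurry
    fun_prop
  rw [integrable_prod_iff' hmeas.aestronglyMeasurable]
  constructor
  · refine Filter.Eventually.of_forall fun t => ?_
    exact (Continuous.integrableOn_Icc (by simp only [Function.uncurry, div_eq_mul_inv]; fun_prop)).mono_set
      Ioc_subset_Icc_self
  · have hexp : IntegrableOn (fun t : ℝ => ξ⁻¹ * Real.exp (-(t / ξ))) (Ioi 0) := by
      have h := (integrableOn_exp_mul_Ioi (neg_lt_zero.2 (inv_pos.2 hξ)) 0).const_mul ξ⁻¹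
      refine h.congr (Filter.Eventually.of_forall fun t => ?_)
      simp only
      congr 2
      ring
    refine hexp.mono' hmeas.norm.stronglyMeasurable.integral_prod_left'.aestronglyMeasurable ?_
    filter_upwards [ae_restrict_mem measurableSet_Ioi] with t ht
    have ht : 0 < t := ht
    have hnorm : ∀ w : ℝ, ‖Function.uncurry (fun w t : ℝ => ξ * (t + 1) / t ^ 2 *
        Real.exp (-(t / ξ) - ξ ^ 2 * (t + 1) * w / t ^ 2)) (w, t)‖ =
        ξ * (t + 1) / t ^ 2 * Real.exp (-(t / ξ) - ξ ^ 2 * (t + 1) * w / t ^ 2) :=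
      fun w => Real.norm_of_nonneg (by simp only [Function.uncurry]; positivity)
    simp only [hnorm]
    rw [← intervalIntegral.integral_of_le hz, integral_joint_density hξ z ht]
    have hle : Real.exp (-(ξ ^ 2 * (t + 1) / t ^ 2 * z)) ≤ 1 :=
      Real.exp_le_one_iff.2 (neg_nonpos.2 (by positivity))
    have hpos := Real.exp_pos (-(ξ ^ 2 * (t + 1) / t ^ 2 * z))
    rw [Real.norm_of_nonneg (mul_nonneg (by positivity) (by linarith))]
    exact mul_le_of_le_one_right (by positivity) (by linarith)

/-- The conditional distribution function of `Z` given `X = x`, weighted by the density of `X`. -/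
lemma integral_ite_ratio_le {ξ : ℝ} (hξ : 0 < ξ) {z : ℝ} (hz : 0 ≤ z) {x : ℝ} (hx : 0 < x) :
    ∫ y in Ioi (0 : ℝ), (if x ^ 2 * y / (ξ * x + 1) ≤ z then (1 : ℝ) else 0) *
        (Real.exp (-x) * Real.exp (-y)) =
      Real.exp (-x) * (1 - Real.exp (-(z * (ξ * x + 1) / x ^ 2))) := by
  rw [← integral_Ioi_ite_le_mul_exp_neg (by positivity), ← integral_const_mul]
  congr 1
  ext y
  have hiff : x ^ 2 * y / (ξ * x + 1) ≤ z ↔ y ≤ z * (ξ * x + 1) / x ^ 2 := by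
    rw [div_le_iff₀ (by positivity), le_div_iff₀ (by positivity), mul_comm y]
  simp only [hiff]
  ring


/-- Exact CDF of `Z = X² Y / (ξ X + 1)` for independent unit-mean exponential `X, Y`
(Appendix B, eq. (48)): for `z ≥ 0`,
`P(Z ≤ z) = ∫_0^z ∫_0^∞ (ξ (t+1)/t²) exp(-t/ξ - ξ² (t+1) w / t²) dt dw`,
where the probability is written as the expectation of the indicator against the
exponential densities `e^{-x} e^{-y}` on `(0,∞)²`. -/
theorem csi_IEH_Z_cdf (ξ : ℝ) (hξ : 0 < ξ) (z : ℝ) (hz : 0 ≤ z) :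
    (∫ x in Ioi (0 : ℝ), ∫ y in Ioi (0 : ℝ),
        (if x ^ 2 * y / (ξ * x + 1) ≤ z then (1 : ℝ) else 0) *
          (Real.exp (-x) * Real.exp (-y))) =
    ∫ w in (0 : ℝ)..z, ∫ t in Ioi (0 : ℝ),
        ξ * (t + 1) / t ^ 2 * Real.exp (-(t / ξ) - ξ ^ 2 * (t + 1) * w / t ^ 2) := by
  rw [intervalIntegral.integral_of_le hz,
    integral_integral_swap (integrable_joint_density hξ hz)]
  have hleft := setIntegral_congr_fun (μ := volume) measurableSet_Ioi
    fun x (hx : x ∈ Ioi (0 : ℝ)) => integral_ite_ratio_le hξ hz hx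
  have hright := setIntegral_congr_fun (μ := volume) measurableSet_Ioi
    fun t (ht : t ∈ Ioi (0 : ℝ)) => integral_joint_density hξ z ht
  simp only [intervalIntegral.integral_of_le hz] at hright
  rw [hleft, hright]
  have hsubst := integral_comp_mul_left_Ioi (fun t : ℝ => Real.exp (-(t / ξ)) *
    (1 - Real.exp (-(ξ ^ 2 * (t + 1) / t ^ 2 * z)))) 0 hξ
  rw [mul_zero, smul_eq_mul, ← integral_const_mul] at hsubst
  simp only [mul_assoc] at hsubst ⊢
  rw [← hsubst]
  refine setIntegral_congr_fun measurableSet_Ioi fun x hx => ?_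
  have hx : x ≠ 0 := ne_of_gt hx
  have h₁ : ξ * x / ξ = x := by field_simp
  have h₂ : z * (ξ * x + 1) / x ^ 2 = ξ ^ 2 * (ξ * x + 1) / (ξ * x) ^ 2 * z := by
    field_simp
  simp only [h₁, h₂]
end

section
/- Let ξ > 0 and B > 0. Then ∫_0^∞ ∫_0^∞ exp( - B x^2 y / (ξ x + 1) ) e^{-x - y} dx dy = ∫_0^∞ ξ (t + 1) e^{-t/ξ} / ( ξ^2 (t + 1) + B t^2 ) dt. (This is the per-relay Chernoff-bound factor for CSI-assisted IEH-relaying obtained in Appendix B, eq. (49), before invoking the table integrals.) -/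
open MeasureTheory Set

/-- The Laplace-type integral `∫_0^∞ e^{-c y} e^{-x - y} dy = e^{-x} / (c + 1)`. -/
lemma integral_exp_neg_mul_mul_exp_sub {c : ℝ} (hc : 0 ≤ c) (x : ℝ) :
    ∫ y in Ioi (0 : ℝ), Real.exp (-(c * y)) * Real.exp (-x - y) = Real.exp (-x) / (c + 1) := by
  have h : ∀ y : ℝ, Real.exp (-(c * y)) * Real.exp (-x - y) =
      Real.exp (-x) * Real.exp (-(c + 1) * y) := fun y => by
    rw [← Real.exp_add, ← Real.exp_add]
    ring_nf
  simp_rw [h]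
  rw [integral_const_mul, integral_exp_mul_Ioi (by linarith)]
  rw [mul_zero, Real.exp_zero, neg_div_neg_eq, mul_one_div]

/-- Per-relay Chernoff-bound factor for CSI-assisted IEH-relaying (Appendix B, eq. (49)):
for `ξ > 0`, `B > 0`,
`∫_0^∞ ∫_0^∞ exp(-B x² y/(ξ x + 1)) e^{-x-y} dx dy
  = ∫_0^∞ ξ (t+1) e^{-t/ξ} / (ξ² (t+1) + B t²) dt`. -/
theorem csi_IEH_per_relay_factor (ξ B : ℝ) (hξ : 0 < ξ) (hB : 0 < B) :
    (∫ x in Ioi (0 : ℝ), ∫ y in Ioi (0 : ℝ),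
        Real.exp (-(B * x ^ 2 * y / (ξ * x + 1))) * Real.exp (-x - y)) =
    ∫ t in Ioi (0 : ℝ),
        ξ * (t + 1) * Real.exp (-(t / ξ)) / (ξ ^ 2 * (t + 1) + B * t ^ 2) := by
  have hsub := integral_comp_mul_left_Ioi
    (fun t => ξ * (t + 1) * Real.exp (-(t / ξ)) / (ξ ^ 2 * (t + 1) + B * t ^ 2)) 0 hξ
  rw [mul_zero, smul_eq_mul, eq_inv_mul_iff_mul_eq₀ hξ.ne'] at hsub
  rw [← hsub, ← integral_const_mul]
  refine setIntegral_congr_fun measurableSet_Ioi fun x hx => ?_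
  have hx : 0 < x := hx
  have hd : 0 < ξ * x + 1 := by positivity
  have hc : 0 ≤ B * x ^ 2 / (ξ * x + 1) := by positivity
  have hD : 0 < ξ * x + 1 + B * x ^ 2 := by positivity
  have hD' : ξ ^ 2 * (ξ * x + 1) + B * (ξ * x) ^ 2 = ξ ^ 2 * (ξ * x + 1 + B * x ^ 2) := by ring
  simp only [mul_div_right_comm (B * x ^ 2), integral_exp_neg_mul_mul_exp_sub hc, hD',
    mul_div_cancel_left₀ x hξ.ne']
  rw [div_add_one hd.ne', add_comm (B * x ^ 2)]
  field_simp
end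

section
/- Closed form of the CSI-assisted IEH per-relay factor (Proposition 2, per-relay factor). Let ξ > 0 and 0 < B < ξ^2/4, and set p = (ξ + √(ξ^2 - 4B))/(2B) and q = (ξ - √(ξ^2 - 4B))/(2B) (so that B x^2 + ξ x + 1 = B (x + p)(x + q) with p, q > 0, p ≠ q). Then ∫_0^∞ ∫_0^∞ exp( - B x^2 y / (ξ x + 1) ) e^{-x-y} dx dy = (1/B) · [ ((1 - ξ p)/(q - p)) e^{p} Γ(0, p) + ((1 - ξ q)/(p - q)) e^{q} Γ(0, q) ], where Γ(0, x) = ∫_x^∞ u^{-1} e^{-u} du. -/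
open MeasureTheory Set

lemma integrableOn_exp_neg_div_add {a : ℝ} (ha : 0 < a) :
    IntegrableOn (fun x : ℝ => Real.exp (-x) / (x + a)) (Ioi 0) := by
  refine Integrable.mono' (integrableOn_exp_neg_Ioi 0 |>.div_const a)
    (Measurable.aestronglyMeasurable (by fun_prop)) ?_
  filter_upwards [ae_restrict_mem measurableSet_Ioi] with x (hx : 0 < x)
  rw [Real.norm_of_nonneg (by positivity)]
  gcongr
  linarith

lemma integral_exp_neg_div_add (a : ℝ) :
    ∫ x in Ioi (0 : ℝ), Real.exp (-x) / (x + a) = Real.exp a * Gamma0 a := by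
  have h := (measurePreserving_add_right volume a).setIntegral_preimage_emb
    (measurableEmbedding_addRight a) (fun u : ℝ => u⁻¹ * Real.exp (-u)) (Ioi a)
  rw [Gamma0, ← h, ← integral_const_mul]
  simp only [preimage_add_const_Ioi, sub_self]
  refine integral_congr_ae (.of_forall fun x => ?_)
  simp only [neg_add, Real.exp_add, Real.exp_neg a]
  field_simp

/-- Closed form of the CSI-assisted IEH per-relay factor (Proposition 2, per-relay
factor): for `ξ > 0`, `0 < B < ξ²/4`, with `p = (ξ + √(ξ² - 4B))/(2B)` and
`q = (ξ - √(ξ² - 4B))/(2B)`,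
`∫_0^∞ ∫_0^∞ exp(-B x² y/(ξ x + 1)) e^{-x-y} dx dy
  = (1/B) [((1 - ξ p)/(q - p)) e^p Γ(0, p) + ((1 - ξ q)/(p - q)) e^q Γ(0, q)]`. -/
theorem csi_IEH_per_relay_factor_closed_form (ξ B : ℝ) (hξ : 0 < ξ) (hB : 0 < B)
    (hBlt : B < ξ ^ 2 / 4) (p q : ℝ)
    (hp : p = (ξ + Real.sqrt (ξ ^ 2 - 4 * B)) / (2 * B))
    (hq : q = (ξ - Real.sqrt (ξ ^ 2 - 4 * B)) / (2 * B)) :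
    (∫ x in Ioi (0 : ℝ), ∫ y in Ioi (0 : ℝ),
        Real.exp (-(B * x ^ 2 * y / (ξ * x + 1))) * Real.exp (-x - y)) =
    (1 / B) * ((1 - ξ * p) / (q - p) * Real.exp p * Gamma0 p +
      (1 - ξ * q) / (p - q) * Real.exp q * Gamma0 q) := by
  have hs : 0 < Real.sqrt (ξ ^ 2 - 4 * B) := Real.sqrt_pos.2 (by linarith)
  have hs2 : Real.sqrt (ξ ^ 2 - 4 * B) ^ 2 = ξ ^ 2 - 4 * B := Real.sq_sqrt (by linarith)
  set s := Real.sqrt (ξ ^ 2 - 4 * B)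
  have hsξ : s < ξ := by nlinarith
  have hp0 : 0 < p := by rw [hp]; positivity
  have hq0 : 0 < q := by rw [hq]; exact div_pos (by linarith) (by linarith)
  have hqp : q < p := by rw [hp, hq]; gcongr; linarith
  have hsum : B * (p + q) = ξ := by rw [hp, hq]; field_simp; ring
  have hprod : B * (p * q) = 1 := by rw [hp, hq]; field_simp; linear_combination -hs2
  have hfactor : ∀ x : ℝ, B * x ^ 2 + ξ * x + 1 = B * ((x + p) * (x + q)) := fun x => by
    linear_combination -x * hsum - hprod
  have hinner : ∀ x ∈ Ioi (0 : ℝ), (∫ y in Ioi (0 : ℝ),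
      Real.exp (-(B * x ^ 2 * y / (ξ * x + 1))) * Real.exp (-x - y)) =
      1 / B * ((1 - ξ * p) / (q - p) * (Real.exp (-x) / (x + p)) +
        (1 - ξ * q) / (p - q) * (Real.exp (-x) / (x + q))) := fun x (hx : 0 < x) => by
    have hd : 0 < ξ * x + 1 := by positivity
    simp_rw [mul_div_right_comm (B * x ^ 2)]
    rw [integral_exp_neg_mul_mul_exp_sub (by positivity), div_add_one hd.ne',
      ← add_assoc, hfactor]
    have hpq : p - q ≠ 0 := by linarith
    have hxp : x + p ≠ 0 := by positivity
    have hxq : x + q ≠ 0 := by positivity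
    rw [← neg_sub p q, div_neg]
    field_simp
    ring
  rw [setIntegral_congr_fun measurableSet_Ioi hinner, integral_const_mul,
    integral_add ((integrableOn_exp_neg_div_add hp0).const_mul _)
      ((integrableOn_exp_neg_div_add hq0).const_mul _),
    integral_const_mul, integral_const_mul, integral_exp_neg_div_add,
    integral_exp_neg_div_add]
  ring
end

section
/- Let ξ ≥ 0 and B ≥ 0. Then ∫_0^∞ ∫_0^∞ exp( - B x y / (ξ x + 1) ) e^{-x-y} dx dy = ∫_0^∞ (ξ t + 1) e^{-t} / ( (B + ξ) t + 1 ) dt. (This is the per-relay Chernoff-bound factor Υ for CSI-assisted AEH-relaying, obtained in Appendix C, eq. (51)–(52).) -/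
open MeasureTheory Set

/-- Per-relay Chernoff-bound factor `Υ` for CSI-assisted AEH-relaying
(Appendix C, eqs. (51)–(52)): for `ξ ≥ 0`, `B ≥ 0`,
`∫_0^∞ ∫_0^∞ exp(-B x y/(ξ x + 1)) e^{-x-y} dx dy
  = ∫_0^∞ (ξ t + 1) e^{-t} / ((B + ξ) t + 1) dt`. -/
theorem csi_AEH_per_relay_factor (ξ B : ℝ) (hξ : 0 ≤ ξ) (hB : 0 ≤ B) :
    (∫ x in Ioi (0 : ℝ), ∫ y in Ioi (0 : ℝ),
        Real.exp (-(B * x * y / (ξ * x + 1))) * Real.exp (-x - y)) =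
    ∫ t in Ioi (0 : ℝ), (ξ * t + 1) * Real.exp (-t) / ((B + ξ) * t + 1) := by
  refine setIntegral_congr_fun measurableSet_Ioi fun x (hx : 0 < x) => ?_
  have hd : 0 < ξ * x + 1 := by positivity
  have hn : 0 < (B + ξ) * x + 1 := by positivity
  have ha : -(((B + ξ) * x + 1) / (ξ * x + 1)) < 0 := neg_neg_of_pos (div_pos hn hd)
  have hfactor : ∀ y : ℝ, Real.exp (-(B * x * y / (ξ * x + 1))) * Real.exp (-x - y) =
      Real.exp (-x) * Real.exp (-(((B + ξ) * x + 1) / (ξ * x + 1)) * y) := fun y => by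
    rw [← Real.exp_add, ← Real.exp_add]
    congr 1
    field_simp
    ring
  simp only [hfactor]
  rw [integral_const_mul, integral_exp_mul_Ioi ha, mul_zero, Real.exp_zero]
  field_simp
end

section
/- CSI-assisted AEH-relaying Chernoff expectation (Proposition 3, equality form). Let a ≥ 0, and for n = 1,2 let ξ_n ≥ 0, B_n > 0 and γ_n = B_n + ξ_n. Then ∫_{(0,∞)^5} exp( -(a w + B_1 x1 y1/(ξ_1 x1 + 1) + B_2 x2 y2/(ξ_2 x2 + 1)) ) e^{-w - x1 - y1 - x2 - y2} dw dx1 dy1 dx2 dy2 = (1 + a)^{-1} ∏_{n=1}^{2} [ γ_n^{-1} e^{1/γ_n} Γ(0, 1/γ_n) + (ξ_n/γ_n) (1 - γ_n^{-1} e^{1/γ_n} Γ(0, 1/γ_n)) ], where Γ(0, x) = ∫_x^∞ u^{-1} e^{-u} du. -/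
open MeasureTheory Set

/-- The Laplace transform of the unit exponential density. -/
lemma integral_exp_neg_mul_sub {c : ℝ} (hc : 0 ≤ c) :
    ∫ y in Ioi (0 : ℝ), Real.exp (-(c * y) - y) = (1 + c)⁻¹ := by
  have h := integral_exp_mul_Ioi (a := -(1 + c)) (by linarith) 0
  have e : ∀ y : ℝ, -(c * y) - y = -(1 + c) * y := fun y => by ring
  simp only [e, h, mul_zero, Real.exp_zero, neg_div_neg_eq, one_div]

/-- Rescaled and shifted form of the exponential integral. -/
lemma integral_inv_mul_exp_neg {γ : ℝ} (hγ : 0 < γ) :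
    ∫ x in Ioi (0 : ℝ), (γ * x + 1)⁻¹ * Real.exp (-x) =
      γ⁻¹ * Real.exp (1 / γ) * Gamma0 (1 / γ) := by
  have h := (measurePreserving_add_right volume (1 / γ)).setIntegral_preimage_emb
    (measurableEmbedding_addRight (1 / γ)) (fun u : ℝ => u⁻¹ * Real.exp (-u)) (Ioi (1 / γ))
  rw [preimage_add_const_Ioi, sub_self] at h
  rw [Gamma0, ← h, ← integral_const_mul]
  refine setIntegral_congr_fun measurableSet_Ioi fun x _ => ?_
  have e : γ * x + 1 = γ * (x + 1 / γ) := by field_simp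
  have e' : Real.exp (-x) = Real.exp (1 / γ) * Real.exp (-(x + 1 / γ)) := by
    rw [← Real.exp_add]; ring_nf
  simp only [e, e', mul_inv]
  ring

lemma integrableOn_inv_mul_exp_neg {γ : ℝ} (hγ : 0 < γ) :
    IntegrableOn (fun x : ℝ => (γ * x + 1)⁻¹ * Real.exp (-x)) (Ioi 0) := by
  refine Integrable.mono' (integrableOn_exp_neg_Ioi 0) (by fun_prop) ?_
  refine (ae_restrict_mem measurableSet_Ioi).mono fun x hx => ?_
  have hx' : 0 < γ * x := mul_pos hγ hx
  rw [Real.norm_of_nonneg (by positivity)]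
  exact mul_le_of_le_one_left (Real.exp_pos _).le (inv_le_one_of_one_le₀ (by linarith))

/-- The Chernoff factor contributed by a single relay. -/
lemma integral_relay_factor {ξ B γ : ℝ} (hξ : 0 ≤ ξ) (hB : 0 < B) (hγ : γ = B + ξ) :
    ∫ x in Ioi (0 : ℝ), ∫ y in Ioi (0 : ℝ),
        Real.exp (-x) * Real.exp (-(B * x / (ξ * x + 1) * y) - y) =
      γ⁻¹ * Real.exp (1 / γ) * Gamma0 (1 / γ) +
        ξ / γ * (1 - γ⁻¹ * Real.exp (1 / γ) * Gamma0 (1 / γ)) := by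
  have hγ0 : 0 < γ := by linarith
  have inner : ∀ x ∈ Ioi (0 : ℝ), ∫ y in Ioi (0 : ℝ),
      Real.exp (-x) * Real.exp (-(B * x / (ξ * x + 1) * y) - y) =
      ξ / γ * Real.exp (-x) + (1 - ξ / γ) * ((γ * x + 1)⁻¹ * Real.exp (-x)) := by
    intro x hx
    have hx : 0 < x := hx
    have h1 : 0 < ξ * x + 1 := by positivity
    have h2 : 0 < γ * x + 1 := by positivity
    have h3 : (1 + B * x / (ξ * x + 1))⁻¹ = (ξ * x + 1) / (γ * x + 1) := by
      rw [inv_eq_one_div, div_eq_div_iff (by positivity) h2.ne', hγ]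
      field_simp
      ring
    rw [integral_const_mul, integral_exp_neg_mul_sub (by positivity), h3]
    field_simp
    ring
  rw [setIntegral_congr_fun measurableSet_Ioi inner,
    integral_add ((integrableOn_exp_neg_Ioi 0).const_mul _)
      ((integrableOn_inv_mul_exp_neg hγ0).const_mul _),
    integral_const_mul, integral_const_mul, integral_inv_mul_exp_neg hγ0, integral_exp_neg_Ioi_zero]
  ring

/-- CSI-assisted AEH-relaying Chernoff expectation (Proposition 3, equality form):
for `a ≥ 0`, `ξₙ ≥ 0`, `Bₙ > 0`, `γₙ = Bₙ + ξₙ`,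
`∫_{(0,∞)^5} e^{-(a w + B₁ x1 y1/(ξ₁ x1 + 1) + B₂ x2 y2/(ξ₂ x2 + 1))} e^{-w-x1-y1-x2-y2}
  = (1+a)⁻¹ ∏ₙ [γₙ⁻¹ e^{1/γₙ} Γ(0,1/γₙ) + (ξₙ/γₙ)(1 - γₙ⁻¹ e^{1/γₙ} Γ(0,1/γₙ))]`. -/
theorem csi_AEH_chernoff_expectation (a ξ₁ ξ₂ B₁ B₂ γ₁ γ₂ : ℝ) (ha : 0 ≤ a)
    (hξ₁ : 0 ≤ ξ₁) (hξ₂ : 0 ≤ ξ₂) (hB₁ : 0 < B₁) (hB₂ : 0 < B₂)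
    (hγ₁ : γ₁ = B₁ + ξ₁) (hγ₂ : γ₂ = B₂ + ξ₂) :
    (∫ w in Ioi (0 : ℝ), ∫ x1 in Ioi (0 : ℝ), ∫ y1 in Ioi (0 : ℝ),
      ∫ x2 in Ioi (0 : ℝ), ∫ y2 in Ioi (0 : ℝ),
        Real.exp (-(a * w + B₁ * x1 * y1 / (ξ₁ * x1 + 1) +
            B₂ * x2 * y2 / (ξ₂ * x2 + 1))) *
          Real.exp (-w - x1 - y1 - x2 - y2)) =
    (1 + a)⁻¹ *
      ((γ₁⁻¹ * Real.exp (1 / γ₁) * Gamma0 (1 / γ₁) +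
          ξ₁ / γ₁ * (1 - γ₁⁻¹ * Real.exp (1 / γ₁) * Gamma0 (1 / γ₁))) *
        (γ₂⁻¹ * Real.exp (1 / γ₂) * Gamma0 (1 / γ₂) +
          ξ₂ / γ₂ * (1 - γ₂⁻¹ * Real.exp (1 / γ₂) * Gamma0 (1 / γ₂)))) := by
  have h : ∀ w x1 y1 x2 y2 : ℝ,
      Real.exp (-(a * w + B₁ * x1 * y1 / (ξ₁ * x1 + 1) + B₂ * x2 * y2 / (ξ₂ * x2 + 1))) *
          Real.exp (-w - x1 - y1 - x2 - y2) =
        Real.exp (-(a * w) - w) *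
          ((Real.exp (-x1) * Real.exp (-(B₁ * x1 / (ξ₁ * x1 + 1) * y1) - y1)) *
            (Real.exp (-x2) * Real.exp (-(B₂ * x2 / (ξ₂ * x2 + 1) * y2) - y2))) := by
    intro w x1 y1 x2 y2
    simp only [← Real.exp_add]
    congr 1
    ring
  rw [← integral_relay_factor hξ₁ hB₁ hγ₁, ← integral_relay_factor hξ₂ hB₂ hγ₂,
    ← integral_exp_neg_mul_sub ha]
  simp only [h, integral_const_mul, integral_mul_const]
end
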